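/- Let κ > 1, 0 < α < π/2, and 1/2 < s < 1. Let S = {z ∈ ℍ : 0 < arg z < α} and let φ : S → ℝ be a smooth function satisfying φ(κz) = φ(z) for all z ∈ S, Δφ = s(1−s)φ on S, and ∫∫_{1<r<κ, 0<θ<α} |φ(re^{iθ})|² dr dθ/(r sin²θ) < ∞. Then there exist C > 0 and θ₀ ∈ (0,α) such that |φ(re^{iθ})| ≤ C·θ^{s} for all r > 0 and all 0 < θ < θ₀. -/

import Mathlib

noncomputable section

open MeasureTheory

/-- Second partial derivative of `φ` in the horizontal direction at `z`. -/
def partialXX (φ : ℂ → ℝ) (z : ℂ) : ℝ :=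
  deriv (deriv (fun x : ℝ => φ (x + z.im * Complex.I))) z.re

/-- Second partial derivative of `φ` in the vertical direction at `z`. -/
def partialYY (φ : ℂ → ℝ) (z : ℂ) : ℝ :=
  deriv (deriv (fun y : ℝ => φ (z.re + y * Complex.I))) z.im


lemma mode_bound (α s l : ℝ) (hα0 : 0 < α) (hαpi : α < Real.pi / 2) (hs : 0 < s)
    (hl : 0 ≤ l) (f f' : ℝ → ℝ)
    (hf : ∀ θ ∈ Set.Ioo 0 α, HasDerivAt f (f' θ) θ)
    (hf' : ∀ θ ∈ Set.Ioo 0 α, HasDerivAt f' ((l - s * (1 - s) / Real.sin θ ^ 2) * f θ) θ)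
    (hno : ∀ c > 0, ∀ δ > 0, δ < α → ¬ ∀ θ ∈ Set.Ioo 0 δ, c * θ ≤ f θ ^ 2)
    (θ θ₁ : ℝ) (h0 : 0 < θ) (h1 : θ ≤ θ₁) (h2 : θ₁ < α) :
    |f θ| * Real.sin θ₁ ^ s ≤ |f θ₁| * Real.sin θ ^ s := by
  have hsin : ∀ x ∈ Set.Ioo 0 α, 0 < Real.sin x := fun x hx =>
    Real.sin_pos_of_pos_of_lt_pi hx.1 (by linarith [hx.2, Real.pi_pos])
  set P : ℝ → ℝ := fun x => 2 * (f x * f' x) - 2 * s * (f x ^ 2 * (Real.cos x / Real.sin x)) with hP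
  have hPd : ∀ x ∈ Set.Ioo 0 α, HasDerivAt P
      (2 * (f' x - s * f x * (Real.cos x / Real.sin x)) ^ 2 + 2 * f x ^ 2 * (l + s ^ 2)) x := by
    intro x hx
    have hsx := hsin x hx
    have e1 := (((hf x hx).mul (hf' x hx)).const_mul 2).sub
      ((((hf x hx).pow 2).mul ((Real.hasDerivAt_cos x).div (Real.hasDerivAt_sin x) hsx.ne')).const_mul (2 * s))
    refine HasDerivAt.congr_deriv (f' := _) e1 ?_
    have hc : Real.cos x ^ 2 = 1 - Real.sin x ^ 2 := by linarith [Real.sin_sq_add_cos_sq x]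
    simp only [Pi.pow_apply, Pi.div_apply]
    field_simp
    ring_nf
    rw [hc]
    ring
  have hPm : MonotoneOn P (Set.Ioo 0 α) := by
    apply monotoneOn_of_deriv_nonneg (convex_Ioo 0 α)
    · exact fun x hx => (hPd x hx).continuousAt.continuousWithinAt
    · intro x hx
      rw [interior_Ioo] at hx
      exact (hPd x hx).differentiableAt.differentiableWithinAt
    · intro x hx
      rw [interior_Ioo] at hx
      rw [(hPd x hx).deriv]
      positivity
  set G : ℝ → ℝ := fun x => f x ^ 2 * Real.sin x ^ (-(2 * s)) with hG
  have hGd : ∀ x ∈ Set.Ioo 0 α, HasDerivAt G (P x * Real.sin x ^ (-(2 * s))) x := by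
    intro x hx
    have hsx := hsin x hx
    have e1 := ((hf x hx).pow 2).mul ((Real.hasDerivAt_sin x).rpow_const (p := -(2 * s)) (Or.inl hsx.ne'))
    refine HasDerivAt.congr_deriv (f' := _) e1 ?_
    simp only [hP, Pi.pow_apply]
    rw [Real.rpow_sub_one hsx.ne']
    field_simp
    ring
  have hPnn : ∀ x ∈ Set.Ioo 0 α, 0 ≤ P x := by
    intro a ha
    by_contra! hneg
    refine hno (-(P a) * 2 ^ (-(2 * s))) (mul_pos (by linarith) (by positivity)) (a / 2)
      (by linarith [ha.1]) (by linarith [ha.1, ha.2]) ?_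
    intro x hx
    have hxa : 2 * x < a := by linarith [hx.2]
    have hx0 : 0 < x := hx.1
    have haα := ha.2
    obtain ⟨ξ, hξ, hslope⟩ := exists_hasDerivAt_eq_slope G
      (fun x => P x * Real.sin x ^ (-(2 * s))) (show x < 2 * x by linarith)
      (fun y hy => (hGd y ⟨by linarith [hy.1], by linarith [hy.2]⟩).continuousAt.continuousWithinAt)
      (fun y hy => hGd y ⟨by linarith [hy.1], by linarith [hy.2]⟩)
    have hξα : ξ ∈ Set.Ioo 0 α := ⟨by linarith [hξ.1], by linarith [hξ.2]⟩
    have hxα : x ∈ Set.Ioo 0 α := ⟨by linarith [hξ.1], by linarith [hξ.2]⟩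
    have hPξ : P ξ ≤ P a := hPm hξα ha (by linarith [hξ.2])
    have hsξ := hsin ξ hξα
    have hsx := hsin x hxα
    have hle : Real.sin ξ ≤ 2 * Real.sin x := by
      have : Real.sin ξ ≤ Real.sin (2 * x) :=
        Real.sin_le_sin_of_le_of_le_pi_div_two (by linarith [hξα.1, Real.pi_pos]) (by linarith) hξ.2.le
      rw [Real.sin_two_mul] at this
      nlinarith [Real.cos_le_one x]
    have hpow : (2 * Real.sin x) ^ (-(2 * s)) ≤ Real.sin ξ ^ (-(2 * s)) :=
      Real.rpow_le_rpow_of_nonpos hsξ hle (by linarith)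
    rw [Real.mul_rpow (by norm_num) hsx.le] at hpow
    have hG2 : 0 ≤ G (2 * x) := by
      have := hsin (2 * x) ⟨by linarith, by linarith⟩
      simp only [hG]; positivity
    have hGx : -(P a) * (2 ^ (-(2 * s)) * Real.sin x ^ (-(2 * s))) * x ≤ G x := by
      have hx2 : 2 * x - x = x := by ring
      rw [hx2, eq_div_iff hx0.ne'] at hslope
      have : -(P a) * (2 ^ (-(2 * s)) * Real.sin x ^ (-(2 * s))) ≤ -(P ξ) * Real.sin ξ ^ (-(2 * s)) := by
        apply mul_le_mul (by linarith) hpow (by positivity) (by linarith)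
      have := mul_le_mul_of_nonneg_right this hx0.le
      linarith
    have hpp : 0 < Real.sin x ^ (-(2 * s)) := by positivity
    simp only [hG] at hGx
    apply le_of_mul_le_mul_right _ hpp
    linarith
  have hGm : MonotoneOn G (Set.Ioo 0 α) := by
    apply monotoneOn_of_deriv_nonneg (convex_Ioo 0 α)
    · exact fun x hx => (hGd x hx).continuousAt.continuousWithinAt
    · intro x hx
      rw [interior_Ioo] at hx
      exact (hGd x hx).differentiableAt.differentiableWithinAt
    · intro x hx
      rw [interior_Ioo] at hx
      rw [(hGd x hx).deriv]
      have := hsin x hx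
      exact mul_nonneg (hPnn x hx) (by positivity)
  have hθ : θ ∈ Set.Ioo 0 α := ⟨h0, by linarith⟩
  have hθ₁ : θ₁ ∈ Set.Ioo 0 α := ⟨by linarith, by linarith⟩
  have key := hGm hθ hθ₁ h1
  have p1 := hsin _ hθ
  have p2 := hsin _ hθ₁
  have q1 : Real.sin θ ^ (-(2 * s)) = ((Real.sin θ ^ s) ^ 2)⁻¹ := by
    rw [Real.rpow_neg p1.le, mul_comm, Real.rpow_mul p1.le]; norm_num
  have q2 : Real.sin θ₁ ^ (-(2 * s)) = ((Real.sin θ₁ ^ s) ^ 2)⁻¹ := by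
    rw [Real.rpow_neg p2.le, mul_comm, Real.rpow_mul p2.le]; norm_num
  simp only [hG, q1, q2] at key
  have r1 : 0 < Real.sin θ ^ s := by positivity
  have r2 : 0 < Real.sin θ₁ ^ s := by positivity
  rw [← div_eq_mul_inv, ← div_eq_mul_inv, div_le_div_iff₀ (by positivity) (by positivity)] at key
  apply le_of_sq_le_sq _ (by positivity)
  rw [mul_pow, mul_pow, sq_abs, sq_abs]
  exact key

/-- differentiate under the integral -/
lemma diff_under (α L : ℝ) (g g' : ℝ → ℝ → ℂ)
    (hg : ContinuousOn (fun p : ℝ × ℝ => g p.1 p.2) (Set.univ ×ˢ Set.Ioo 0 α))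
    (hg' : ContinuousOn (fun p : ℝ × ℝ => g' p.1 p.2) (Set.univ ×ˢ Set.Ioo 0 α))
    (hd : ∀ t, ∀ θ ∈ Set.Ioo 0 α, HasDerivAt (fun θ => g t θ) (g' t θ) θ)
    (θ : ℝ) (hθ : θ ∈ Set.Ioo 0 α) :
    HasDerivAt (fun θ => ∫ t in (0:ℝ)..L, g t θ) (∫ t in (0:ℝ)..L, g' t θ) θ := by
  have slice : ∀ (k : ℝ → ℝ → ℂ), ContinuousOn (fun p : ℝ × ℝ => k p.1 p.2) (Set.univ ×ˢ Set.Ioo 0 α) →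
      ∀ x ∈ Set.Ioo 0 α, Continuous (fun t => k t x) := by
    intro k hk x hx
    have : Continuous (fun t : ℝ => ((t, x) : ℝ × ℝ)) := by fun_prop
    exact hk.comp_continuous this (fun t => ⟨trivial, hx⟩)
  obtain ⟨ε, hε, hball⟩ : ∃ ε > 0, Metric.closedBall θ ε ⊆ Set.Ioo 0 α :=
    Metric.nhds_basis_closedBall.mem_iff.1 (isOpen_Ioo.mem_nhds hθ)
  obtain ⟨B, hB⟩ := (isCompact_uIcc (a := (0:ℝ)) (b := L)).prod (isCompact_closedBall θ ε) |>.exists_bound_of_continuousOn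
    (hg'.mono (Set.prod_mono (Set.subset_univ _) hball))
  refine (intervalIntegral.hasDerivAt_integral_of_dominated_loc_of_deriv_le (bound := fun _ => B)
    (F := fun x t => g t x) (F' := fun x t => g' t x)
    (Metric.ball_mem_nhds θ hε) ?_ ?_ ?_ ?_ ?_ ?_).2
  · filter_upwards [isOpen_Ioo.mem_nhds hθ] with x hx
    exact (slice g hg x hx).aestronglyMeasurable
  · exact (slice g hg θ hθ).intervalIntegrable _ _
  · exact (slice g' hg' θ hθ).aestronglyMeasurable
  · refine Filter.Eventually.of_forall fun t ht x hx => ?_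
    exact hB (t, x) ⟨Set.uIoc_subset_uIcc ht, Metric.ball_subset_closedBall hx⟩
  · exact intervalIntegrable_const
  · refine Filter.Eventually.of_forall fun t ht x hx => ?_
    exact hd t x (hball (Metric.ball_subset_closedBall hx))

/-- second derivative along a curve -/
lemma curve_deriv (φ : ℂ → ℝ) (S : Set ℂ) (hS : IsOpen S) (h : ContDiffOn ℝ (⊤ : ℕ∞) φ S)
    (γ γ' : ℝ → ℂ) (γ'' : ℂ) (t : ℝ) (hγ : HasDerivAt γ (γ' t) t) (hγ' : HasDerivAt γ' γ'' t)
    (hm : γ t ∈ S) :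
    HasDerivAt (fun t => φ (γ t)) (fderiv ℝ φ (γ t) (γ' t)) t ∧
    HasDerivAt (fun t => fderiv ℝ φ (γ t) (γ' t))
      (fderiv ℝ (fderiv ℝ φ) (γ t) (γ' t) (γ' t) + fderiv ℝ φ (γ t) γ'') t := by
  have hn := hS.mem_nhds hm
  have h1 : DifferentiableAt ℝ φ (γ t) := (h.contDiffAt hn).differentiableAt (by simp)
  have h2 : ContDiffOn ℝ (⊤ : ℕ∞) (fderiv ℝ φ) S := h.fderiv_of_isOpen hS (by simp)
  have h3 : DifferentiableAt ℝ (fderiv ℝ φ) (γ t) := (h2.contDiffAt hn).differentiableAt (by simp)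
  exact ⟨h1.hasFDerivAt.comp_hasDerivAt t hγ, (h3.hasFDerivAt.comp_hasDerivAt t hγ).clm_apply hγ'⟩

lemma isOpen_sector (α : ℝ) (hαpi : α < Real.pi / 2) : IsOpen {z : ℂ | 0 < z.arg ∧ z.arg < α} := by
  rw [isOpen_iff_mem_nhds]
  intro z hz
  have hsl : z ∈ Complex.slitPlane := by
    rw [Complex.mem_slitPlane_iff_arg]
    refine ⟨by linarith [hz.2, Real.pi_pos], ?_⟩
    rintro rfl
    simp at hz
  have hc := Complex.continuousAt_arg hsl
  exact hc.preimage_mem_nhds (isOpen_Ioo.mem_nhds hz)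

lemma arg_polar (t θ α : ℝ) (hαpi : α < Real.pi / 2) (hθ : θ ∈ Set.Ioo 0 α) :
    (Complex.exp (t + θ * Complex.I)).arg = θ := by
  rw [Complex.exp_add, ← Complex.ofReal_exp, Complex.arg_real_mul _ (Real.exp_pos t), Complex.arg_exp_mul_I]
  rw [toIocMod_eq_self]
  constructor <;> linarith [hθ.1, hθ.2, Real.pi_pos]

lemma cs_interval (L : ℝ) (hL : 0 < L) (v : ℝ → ℝ) (hv : Continuous v) :
    (∫ t in (0:ℝ)..L, v t) ^ 2 ≤ L * ∫ t in (0:ℝ)..L, v t ^ 2 := by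
  set m := ∫ t in (0:ℝ)..L, v t with hm
  have h1 : 0 ≤ ∫ t in (0:ℝ)..L, (L * v t - m) ^ 2 :=
    intervalIntegral.integral_nonneg hL.le (fun t _ => sq_nonneg _)
  have h2 : ∫ t in (0:ℝ)..L, (L * v t - m) ^ 2
      = L ^ 2 * (∫ t in (0:ℝ)..L, v t ^ 2) - 2 * L * m * m + m ^ 2 * L := by
    have : ∀ t, (L * v t - m) ^ 2 = L ^ 2 * v t ^ 2 - 2 * L * m * v t + m ^ 2 := fun t => by ring
    simp_rw [this]
    rw [intervalIntegral.integral_add, intervalIntegral.integral_sub,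
      intervalIntegral.integral_const_mul, intervalIntegral.integral_const_mul,
      intervalIntegral.integral_const, ← hm]
    · simp; ring
    all_goals apply Continuous.intervalIntegrable; fun_prop
  rw [h2] at h1
  have : 0 ≤ L * (L * (∫ t in (0:ℝ)..L, v t ^ 2) - m ^ 2) := by nlinarith
  nlinarith [nonneg_of_mul_nonneg_right this hL]

lemma flare_core (α s L : ℝ) (hα0 : 0 < α) (hαpi : α < Real.pi / 2) (hs : 0 < s) (hL : 0 < L)
    (u ut utt uh uhh : ℝ → ℝ → ℝ)
    (cu : ContinuousOn (fun p : ℝ × ℝ => u p.1 p.2) (Set.univ ×ˢ Set.Ioo 0 α))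
    (cut : ContinuousOn (fun p : ℝ × ℝ => ut p.1 p.2) (Set.univ ×ˢ Set.Ioo 0 α))
    (cutt : ContinuousOn (fun p : ℝ × ℝ => utt p.1 p.2) (Set.univ ×ˢ Set.Ioo 0 α))
    (cuh : ContinuousOn (fun p : ℝ × ℝ => uh p.1 p.2) (Set.univ ×ˢ Set.Ioo 0 α))
    (cuhh : ContinuousOn (fun p : ℝ × ℝ => uhh p.1 p.2) (Set.univ ×ˢ Set.Ioo 0 α))
    (dt : ∀ t, ∀ θ ∈ Set.Ioo 0 α, HasDerivAt (fun t => u t θ) (ut t θ) t)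
    (dtt : ∀ t, ∀ θ ∈ Set.Ioo 0 α, HasDerivAt (fun t => ut t θ) (utt t θ) t)
    (dh : ∀ t, ∀ θ ∈ Set.Ioo 0 α, HasDerivAt (fun θ => u t θ) (uh t θ) θ)
    (dhh : ∀ t, ∀ θ ∈ Set.Ioo 0 α, HasDerivAt (fun θ => uh t θ) (uhh t θ) θ)
    (per : ∀ t, ∀ θ ∈ Set.Ioo 0 α, u (t + L) θ = u t θ)
    (pde : ∀ t, ∀ θ ∈ Set.Ioo 0 α, uhh t θ = - utt t θ - s * (1 - s) / Real.sin θ ^ 2 * u t θ)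
    (hno : ∀ c > 0, ∀ δ > 0, δ < α → ¬ ∀ θ ∈ Set.Ioo 0 δ, c * θ ≤ ∫ t in (0:ℝ)..L, u t θ ^ 2) :
    ∃ C : ℝ, 0 < C ∧ ∀ t, ∀ θ, 0 < θ → θ < α / 2 → |u t θ| ≤ C * θ ^ s := by
  have slice : ∀ (k : ℝ → ℝ → ℝ), ContinuousOn (fun p : ℝ × ℝ => k p.1 p.2) (Set.univ ×ˢ Set.Ioo 0 α) →
      ∀ x ∈ Set.Ioo 0 α, Continuous (fun t => k t x) := by
    intro k hk x hx
    have : Continuous (fun t : ℝ => ((t, x) : ℝ × ℝ)) := by fun_prop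
    exact hk.comp_continuous this (fun t => ⟨trivial, hx⟩)
  have pert : ∀ t, ∀ θ ∈ Set.Ioo 0 α, ut (t + L) θ = ut t θ := by
    intro t θ hθ
    have h1 : HasDerivAt (fun t => u (t + L) θ) (ut (t + L) θ) t :=
      (dt (t + L) θ hθ).comp_add_const t L
    have h2 : (fun t => u (t + L) θ) = fun t => u t θ := funext fun t => per t θ hθ
    rw [h2] at h1
    exact h1.unique (dt t θ hθ)
  -- the modes
  set w : ℤ → ℂ := fun n => 2 * Real.pi * Complex.I * ((-n : ℤ) : ℂ) / L with hw
  set e : ℤ → ℝ → ℂ := fun n t => Complex.exp (w n * t) with he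
  have hLc : (L : ℂ) ≠ 0 := by exact_mod_cast hL.ne'
  have ce : ∀ n, Continuous (e n) := by intro n; simp only [he]; fun_prop
  have de : ∀ n t, HasDerivAt (e n) (w n * e n t) t := by
    intro n t
    have h1 : HasDerivAt (fun t : ℝ => w n * (t : ℂ)) (w n * 1) t :=
      (Complex.ofRealCLM.hasDerivAt (x := t)).const_mul (w n)
    have := h1.cexp
    simp only [he]
    convert this using 1
    ring
  have e0 : ∀ n, e n 0 = 1 := by intro n; simp [he]
  have eL : ∀ n, e n L = 1 := by
    intro n
    simp only [he, hw]
    rw [div_mul_cancel₀ _ hLc, Complex.exp_eq_one_iff]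
    exact ⟨-n, by ring⟩
  have ne1 : ∀ n t, ‖e n t‖ = 1 := by
    intro n t
    have : w n * t = ((2 * Real.pi * ((-n : ℤ) : ℝ) / L * t : ℝ) : ℂ) * Complex.I := by
      simp only [hw]; push_cast; ring
    simp only [he]
    rw [this, Complex.norm_exp_ofReal_mul_I]
  have w2 : ∀ n, w n ^ 2 = ((-(2 * Real.pi * n / L) ^ 2 : ℝ) : ℂ) := by
    intro n
    simp only [hw]; push_cast
    rw [div_pow, mul_pow, mul_pow, Complex.I_sq]; ring
  set M : (ℝ → ℝ → ℝ) → ℤ → ℝ → ℂ := fun k n θ => ∫ t in (0:ℝ)..L, (k t θ : ℂ) * e n t with hM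
  have dM : ∀ k k' : ℝ → ℝ → ℝ, ContinuousOn (fun p : ℝ × ℝ => k p.1 p.2) (Set.univ ×ˢ Set.Ioo 0 α) →
      ContinuousOn (fun p : ℝ × ℝ => k' p.1 p.2) (Set.univ ×ˢ Set.Ioo 0 α) →
      (∀ t, ∀ θ ∈ Set.Ioo 0 α, HasDerivAt (fun θ => k t θ) (k' t θ) θ) →
      ∀ n, ∀ θ ∈ Set.Ioo 0 α, HasDerivAt (M k n) (M k' n θ) θ := by
    intro k k' hk hk' hd n θ hθ
    have hee : ContinuousOn (fun p : ℝ × ℝ => e n p.1) (Set.univ ×ˢ Set.Ioo 0 α) :=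
      ((ce n).comp continuous_fst).continuousOn
    refine diff_under α L (fun t θ => (k t θ : ℂ) * e n t) (fun t θ => (k' t θ : ℂ) * e n t) ?_ ?_ ?_ θ hθ
    · exact (Complex.continuous_ofReal.comp_continuousOn hk).mul hee
    · exact (Complex.continuous_ofReal.comp_continuousOn hk').mul hee
    · intro t θ hθ
      exact (hd t θ hθ).ofReal_comp.mul_const _
  -- integration by parts
  have ibp : ∀ k k' : ℝ → ℝ → ℝ, 
      ContinuousOn (fun p : ℝ × ℝ => k' p.1 p.2) (Set.univ ×ˢ Set.Ioo 0 α) →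
      (∀ t, ∀ θ ∈ Set.Ioo 0 α, HasDerivAt (fun t => k t θ) (k' t θ) t) →
      (∀ t, ∀ θ ∈ Set.Ioo 0 α, k (t + L) θ = k t θ) →
      ∀ n, ∀ θ ∈ Set.Ioo 0 α, M k' n θ = - w n * M k n θ := by
    intro k k' hk' hd hp n θ hθ
    have hib := intervalIntegral.integral_mul_deriv_eq_deriv_mul (a := 0) (b := L)
      (u := e n) (v := fun t => (k t θ : ℂ)) (u' := fun t => w n * e n t) (v' := fun t => (k' t θ : ℂ))
      (fun t _ => de n t) (fun t _ => (hd t θ hθ).ofReal_comp)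
      ((continuous_const.mul (ce n)).intervalIntegrable _ _)
      ((Complex.continuous_ofReal.comp (slice k' hk' θ hθ)).intervalIntegrable _ _)
    have hk0 : k L θ = k 0 θ := by simpa using hp 0 θ hθ
    rw [e0, eL, hk0, sub_self, zero_sub] at hib
    simp only [hM]
    rw [neg_mul, ← intervalIntegral.integral_const_mul]
    simp_rw [mul_comm _ (e n _)]
    rw [hib]
    congr 1
    apply intervalIntegral.integral_congr
    intro t _
    simp only; ring
  have hMtt : ∀ n, ∀ θ ∈ Set.Ioo 0 α, M utt n θ = ((-(2 * Real.pi * n / L) ^ 2 : ℝ) : ℂ) * M u n θ := by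
    intro n θ hθ
    rw [ibp ut utt cutt dtt pert n θ hθ, ibp u ut cut dt per n θ hθ, ← w2]; ring
  have hMhh : ∀ n, ∀ θ ∈ Set.Ioo 0 α, M uhh n θ =
      (((2 * Real.pi * n / L) ^ 2 - s * (1 - s) / Real.sin θ ^ 2 : ℝ) : ℂ) * M u n θ := by
    intro n θ hθ
    have : M uhh n θ = - M utt n θ - ((s * (1 - s) / Real.sin θ ^ 2 : ℝ) : ℂ) * M u n θ := by
      simp only [hM]
      rw [← intervalIntegral.integral_const_mul, ← intervalIntegral.integral_neg,
        ← intervalIntegral.integral_sub]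
      · apply intervalIntegral.integral_congr
        intro t _
        simp only [pde t θ hθ]; push_cast; ring
      · exact ((Complex.continuous_ofReal.comp (slice _ cutt θ hθ)).mul (ce n)).neg.intervalIntegrable _ _
      · exact (continuous_const.mul ((Complex.continuous_ofReal.comp (slice _ cu θ hθ)).mul (ce n))).intervalIntegrable _ _
    rw [this, hMtt n θ hθ]; push_cast; ring
  have normM : ∀ k : ℝ → ℝ → ℝ, ∀ n θ, ‖M k n θ‖ ≤ ∫ t in (0:ℝ)..L, |k t θ| := by
    intro k n θ
    simp only [hM]
    refine (intervalIntegral.norm_integral_le_integral_norm hL.le).trans_eq ?_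
    apply intervalIntegral.integral_congr
    intro t _
    simp [ne1]
  have sqM : ∀ n, ∀ θ ∈ Set.Ioo 0 α, ‖M u n θ‖ ^ 2 ≤ L * ∫ t in (0:ℝ)..L, u t θ ^ 2 := by
    intro n θ hθ
    have h1 := cs_interval L hL (fun t => |u t θ|) (slice _ cu θ hθ).abs
    simp only [sq_abs] at h1
    exact (pow_le_pow_left₀ (norm_nonneg _) (normM u n θ) 2).trans h1
  have hnoM : ∀ n, ∀ f : ℝ → ℝ, (∀ θ, |f θ| ≤ ‖M u n θ‖) →
      ∀ c > 0, ∀ δ > 0, δ < α → ¬ ∀ θ ∈ Set.Ioo 0 δ, c * θ ≤ f θ ^ 2 := by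
    intro n f hf c hc δ hδ hδα hall
    refine hno (c / L) (by positivity) δ hδ hδα ?_
    intro θ hθ
    have h1 := sqM n θ ⟨hθ.1, hθ.2.trans hδα⟩
    have h2 := pow_le_pow_left₀ (abs_nonneg _) (hf θ) 2
    rw [sq_abs] at h2
    have h3 := hall θ hθ
    rw [div_mul_eq_mul_div, div_le_iff₀ hL]
    linarith
  set θ₁ := α / 2 with hθ₁
  have hθ₁m : θ₁ ∈ Set.Ioo 0 α := ⟨by linarith, by linarith⟩
  have hsin1 : 0 < Real.sin θ₁ := Real.sin_pos_of_pos_of_lt_pi hθ₁m.1 (by linarith [Real.pi_pos])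
  have main : ∀ n θ, 0 < θ → θ < θ₁ →
      ‖M u n θ‖ * Real.sin θ₁ ^ s ≤ 2 * ‖M u n θ₁‖ * Real.sin θ ^ s := by
    intro n θ h0 h1
    have hre := mode_bound α s ((2 * Real.pi * n / L) ^ 2) hα0 hαpi hs (sq_nonneg _)
      (fun θ => (M u n θ).re) (fun θ => (M uh n θ).re)
      (fun θ hθ => (Complex.reCLM.hasFDerivAt.comp_hasDerivAt θ (dM u uh cu cuh dh n θ hθ)))
      (fun θ hθ => by
        have := (Complex.reCLM.hasFDerivAt.comp_hasDerivAt θ (dM uh uhh cuh cuhh dhh n θ hθ))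
        rw [hMhh n θ hθ, Complex.reCLM_apply, Complex.re_ofReal_mul] at this
        exact this)
      (hnoM n _ (fun θ => Complex.abs_re_le_norm _)) θ θ₁ h0 h1.le hθ₁m.2
    have him := mode_bound α s ((2 * Real.pi * n / L) ^ 2) hα0 hαpi hs (sq_nonneg _)
      (fun θ => (M u n θ).im) (fun θ => (M uh n θ).im)
      (fun θ hθ => (Complex.imCLM.hasFDerivAt.comp_hasDerivAt θ (dM u uh cu cuh dh n θ hθ)))
      (fun θ hθ => by
        have := (Complex.imCLM.hasFDerivAt.comp_hasDerivAt θ (dM uh uhh cuh cuhh dhh n θ hθ))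
        rw [hMhh n θ hθ, Complex.imCLM_apply, Complex.im_ofReal_mul] at this
        exact this)
      (hnoM n _ (fun θ => Complex.abs_im_le_norm _)) θ θ₁ h0 h1.le hθ₁m.2
    have hsin0 : 0 < Real.sin θ := Real.sin_pos_of_pos_of_lt_pi h0 (by linarith [Real.pi_pos])
    have p1 : 0 < Real.sin θ ^ s := by positivity
    have p2 : 0 < Real.sin θ₁ ^ s := by positivity
    have a1 := mul_le_mul_of_nonneg_right (Complex.norm_le_abs_re_add_abs_im (M u n θ)) p2.le
    have a2 := mul_le_mul_of_nonneg_right (Complex.abs_re_le_norm (M u n θ₁)) p1.le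
    have a3 := mul_le_mul_of_nonneg_right (Complex.abs_im_le_norm (M u n θ₁)) p1.le
    linarith
  -- summability at θ₁
  have sum1 : Summable (fun n : ℤ => ‖M u n θ₁‖) := by
    set B := ∫ t in (0:ℝ)..L, |utt t θ₁| with hB
    have hb : Summable (fun n : ℤ => B * (L / (2 * Real.pi)) ^ 2 * (1 / (n : ℝ) ^ 2)) :=
      (Real.summable_one_div_int_pow.2 (by norm_num)).mul_left _
    refine Summable.of_norm_bounded_eventually hb ?_
    filter_upwards [(Set.finite_singleton (0:ℤ)).compl_mem_cofinite] with n hn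
    have hn0 : (n : ℝ) ≠ 0 := by exact_mod_cast hn
    have h1 := normM utt n θ₁
    rw [hMtt n θ₁ hθ₁m, norm_mul, Complex.norm_real, norm_neg, Real.norm_of_nonneg (sq_nonneg _)] at h1
    rw [norm_norm]
    have hpos : 0 < (2 * Real.pi * n / L) ^ 2 := by have := Real.pi_pos; positivity
    rw [← le_div_iff₀' hpos] at h1
    refine h1.trans_eq ?_
    rw [← hB]
    have := Real.pi_pos
    field_simp
  set K := ∑' n : ℤ, ‖M u n θ₁‖ with hK
  have hK0 : 0 ≤ K := tsum_nonneg fun n => norm_nonneg _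
  have hp1 : 0 < Real.sin θ₁ ^ s := by positivity
  refine ⟨1 / L * (2 / Real.sin θ₁ ^ s) * K + 1, by positivity, ?_⟩
  intro t θ h0 h1
  have hθm : θ ∈ Set.Ioo 0 α := ⟨h0, by linarith⟩
  have hsin0 : 0 < Real.sin θ := Real.sin_pos_of_pos_of_lt_pi h0 (by linarith [Real.pi_pos])
  haveI : Fact (0 < L) := ⟨hL⟩
  have hperiodic : Function.Periodic (fun t => (u t θ : ℂ)) L := fun t => by
    simp only [per t θ hθm]
  let F : C(AddCircle L, ℂ) := ⟨hperiodic.lift,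
    (Complex.continuous_ofReal.comp (slice _ cu θ hθm)).quotient_liftOn' _⟩
  have hFc : ∀ n, fourierCoeff F n = (1 / L) • M u n θ := by
    intro n
    rw [fourierCoeff_eq_intervalIntegral _ n 0, zero_add]
    congr 1
    apply intervalIntegral.integral_congr
    intro x _
    simp only [fourier_coe_apply, smul_eq_mul]
    change _ * (u x θ : ℂ) = (u x θ : ℂ) * e n x
    rw [mul_comm]
    congr 1
    simp only [he, hw]
    congr 1
    ring
  have bnd : ∀ n, ‖fourierCoeff F n‖ ≤ 1 / L * (2 / Real.sin θ₁ ^ s) * Real.sin θ ^ s * ‖M u n θ₁‖ := by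
    intro n
    rw [hFc, norm_smul, Real.norm_of_nonneg (by positivity), mul_assoc, mul_assoc]
    refine mul_le_mul_of_nonneg_left ?_ (by positivity)
    rw [div_mul_eq_mul_div, le_div_iff₀ hp1]
    linarith [main n θ h0 h1]
  have sb := sum1.mul_left (1 / L * (2 / Real.sin θ₁ ^ s) * Real.sin θ ^ s)
  have hsum : Summable (fourierCoeff F) := Summable.of_norm_bounded sb bnd
  have hps := has_pointwise_sum_fourier_series_of_summable hsum (t : AddCircle L)
  have hval : F (t : AddCircle L) = (u t θ : ℂ) := rfl
  have hfin : ‖(u t θ : ℂ)‖ ≤ 1 / L * (2 / Real.sin θ₁ ^ s) * Real.sin θ ^ s * K := by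
    rw [← hval, ← hps.tsum_eq]
    refine tsum_of_norm_bounded (sum1.hasSum.mul_left _) ?_
    intro n
    rw [norm_smul, show ‖fourier n (t : AddCircle L)‖ = 1 from Circle.norm_coe _, mul_one]
    exact bnd n
  rw [Complex.norm_real, Real.norm_eq_abs] at hfin
  refine hfin.trans ?_
  have hle : Real.sin θ ^ s ≤ θ ^ s := Real.rpow_le_rpow hsin0.le (Real.sin_le h0.le) hs.le
  have hth : 0 ≤ θ ^ s := by positivity
  have h5 : 0 ≤ 1 / L * (2 / Real.sin θ₁ ^ s) * K := by positivity
  nlinarith [mul_le_mul_of_nonneg_left hle h5]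

lemma flare_pde (α s : ℝ) (hαpi : α < Real.pi / 2) (φ : ℂ → ℝ)
    (hsmooth : ContDiffOn ℝ (⊤ : ℕ∞) φ {z : ℂ | 0 < z.arg ∧ z.arg < α})
    (heig : ∀ z : ℂ, 0 < z.arg → z.arg < α →
      -(z.im ^ 2) * (partialXX φ z + partialYY φ z) = s * (1 - s) * φ z)
    (z : ℂ) (r θ : ℝ) (hr : 0 < r) (hzr : z = r * Complex.exp (θ * Complex.I)) (hz : 0 < z.arg ∧ z.arg < α)
    (hsin : 0 < Real.sin θ) :
    fderiv ℝ (fderiv ℝ φ) z (Complex.I * z) (Complex.I * z) + fderiv ℝ φ z (Complex.I * (Complex.I * z))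
      = - (fderiv ℝ (fderiv ℝ φ) z z z + fderiv ℝ φ z z) - s * (1 - s) / Real.sin θ ^ 2 * φ z := by
  have hS := isOpen_sector α hαpi
  have hX : partialXX φ z = fderiv ℝ (fderiv ℝ φ) z 1 1 := by
    have hd : ∀ x : ℝ, HasDerivAt (fun x : ℝ => (x : ℂ) + z.im * Complex.I) 1 x := fun x =>
      (Complex.ofRealCLM.hasDerivAt (x := x)).add_const _
    have hzz : (z.re : ℂ) + z.im * Complex.I = z := Complex.re_add_im z
    have hmem : ∀ᶠ x : ℝ in nhds z.re, (x : ℂ) + z.im * Complex.I ∈ {z : ℂ | 0 < z.arg ∧ z.arg < α} := by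
      apply (hd z.re).continuousAt.preimage_mem_nhds
      rw [hzz]; exact hS.mem_nhds hz
    have key := fun x hx => curve_deriv φ _ hS hsmooth (fun x : ℝ => (x : ℂ) + z.im * Complex.I)
      (fun _ => 1) 0 x (hd x) (hasDerivAt_const _ _) hx
    unfold partialXX
    rw [Filter.EventuallyEq.deriv_eq (hmem.mono fun x hx => (key x hx).1.deriv),
      (key z.re hmem.self_of_nhds).2.deriv, hzz]
    simp
  have hY : partialYY φ z = fderiv ℝ (fderiv ℝ φ) z Complex.I Complex.I := by
    have hd : ∀ x : ℝ, HasDerivAt (fun x : ℝ => (z.re : ℂ) + x * Complex.I) Complex.I x := fun x => by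
      have := ((Complex.ofRealCLM.hasDerivAt (x := x)).mul_const Complex.I).const_add (z.re : ℂ)
      simpa using this
    have hzz : (z.re : ℂ) + z.im * Complex.I = z := Complex.re_add_im z
    have hmem : ∀ᶠ x : ℝ in nhds z.im, (z.re : ℂ) + x * Complex.I ∈ {z : ℂ | 0 < z.arg ∧ z.arg < α} := by
      apply (hd z.im).continuousAt.preimage_mem_nhds
      rw [hzz]; exact hS.mem_nhds hz
    have key := fun x hx => curve_deriv φ _ hS hsmooth (fun x : ℝ => (z.re : ℂ) + x * Complex.I)
      (fun _ => Complex.I) 0 x (hd x) (hasDerivAt_const _ _) hx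
    unfold partialYY
    rw [Filter.EventuallyEq.deriv_eq (hmem.mono fun x hx => (key x hx).1.deriv),
      (key z.im hmem.self_of_nhds).2.deriv, hzz]
    simp
  have he := heig z hz.1 hz.2
  rw [hX, hY] at he
  set D2 := fderiv ℝ (fderiv ℝ φ) z
  set D := fderiv ℝ φ z
  have z1 : z = z.re • (1:ℂ) + z.im • Complex.I := by
    rw [Complex.real_smul, Complex.real_smul, mul_one, Complex.re_add_im]
  have z2 : Complex.I * z = (-z.im) • (1:ℂ) + z.re • Complex.I := by
    apply Complex.ext <;> simp
  have b1 : D2 z z = z.re ^ 2 * D2 1 1 + z.re * z.im * (D2 1 Complex.I + D2 Complex.I 1)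
      + z.im ^ 2 * D2 Complex.I Complex.I := by
    conv_lhs => rw [z1]
    simp only [map_add, map_smul, ContinuousLinearMap.add_apply, ContinuousLinearMap.smul_apply, smul_eq_mul]
    ring
  have b2 : D2 (Complex.I * z) (Complex.I * z) = z.im ^ 2 * D2 1 1 - z.re * z.im * (D2 1 Complex.I + D2 Complex.I 1)
      + z.re ^ 2 * D2 Complex.I Complex.I := by
    rw [z2]
    simp only [map_add, map_smul, ContinuousLinearMap.add_apply, ContinuousLinearMap.smul_apply, smul_eq_mul]
    ring
  have b3 : D (Complex.I * (Complex.I * z)) = - D z := by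
    rw [← mul_assoc, Complex.I_mul_I, neg_one_mul, map_neg]
  have him : z.im = r * Real.sin θ := by
    rw [hzr]; simp [Complex.exp_ofReal_mul_I_im]
  have hre : z.re = r * Real.cos θ := by
    rw [hzr]; simp [Complex.exp_ofReal_mul_I_re]
  rw [b1, b2, b3]
  rw [him] at he ⊢
  rw [hre]
  have hc : Real.cos θ ^ 2 = 1 - Real.sin θ ^ 2 := by linarith [Real.sin_sq_add_cos_sq θ]
  have : s * (1 - s) / Real.sin θ ^ 2 * φ z = - (r ^ 2 * (D2 1 1 + D2 Complex.I Complex.I)) := by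
    rw [div_mul_eq_mul_div, ← he]; field_simp
  rw [this, mul_pow, mul_pow, hc]
  ring

lemma flare_no (κ α : ℝ) (hκ : 1 < κ) (hα0 : 0 < α) (hαpi : α < Real.pi / 2) (φ : ℂ → ℝ)
    (hcont : ∀ θ ∈ Set.Ioo 0 α, Continuous fun t : ℝ => φ (Complex.exp (t + θ * Complex.I)))
    (hL2 : IntegrableOn
      (fun p : ℝ × ℝ =>
        φ (p.1 * Complex.exp (p.2 * Complex.I)) ^ 2 / (p.1 * Real.sin p.2 ^ 2))
      (Set.Ioo 1 κ ×ˢ Set.Ioo 0 α)) :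
    ∀ c > 0, ∀ δ > 0, δ < α → ¬ ∀ θ ∈ Set.Ioo 0 δ,
      c * θ ≤ ∫ t in (0:ℝ)..Real.log κ, φ (Complex.exp (t + θ * Complex.I)) ^ 2 := by
  intro c hc δ hδ hδα hall
  have hI : Integrable (fun p : ℝ × ℝ =>
        φ (p.1 * Complex.exp (p.2 * Complex.I)) ^ 2 / (p.1 * Real.sin p.2 ^ 2))
      ((volume.restrict (Set.Ioo 1 κ)).prod (volume.restrict (Set.Ioo 0 α))) := by
    rw [Measure.prod_restrict]; exact hL2
  have hJ := hI.integral_prod_right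
  have hJ' : IntegrableOn (fun θ : ℝ => ∫ r in Set.Ioo 1 κ,
      φ (r * Complex.exp (θ * Complex.I)) ^ 2 / (r * Real.sin θ ^ 2)) (Set.Ioo 0 α) := hJ
  have hJ2 := hJ'.mono_set (Set.Ioo_subset_Ioo_right hδα.le)
  have hval : ∀ θ ∈ Set.Ioo 0 α, ∫ r in Set.Ioo 1 κ,
      φ (r * Complex.exp (θ * Complex.I)) ^ 2 / (r * Real.sin θ ^ 2) =
      (∫ t in (0:ℝ)..Real.log κ, φ (Complex.exp (t + θ * Complex.I)) ^ 2) / Real.sin θ ^ 2 := by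
    intro θ hθ
    rw [← integral_Ioc_eq_integral_Ioo, ← intervalIntegral.integral_of_le hκ.le,
      ← intervalIntegral.integral_div]
    have hcv := intervalIntegral.integral_comp_mul_deriv''' (a := 1) (b := κ) (f := Real.log) (f' := fun r => r⁻¹)
      (g := fun t : ℝ => φ (Complex.exp (t + θ * Complex.I)) ^ 2 / Real.sin θ ^ 2)
      (Real.continuousOn_log.mono (by
        intro x hx; rw [Set.uIcc_of_le hκ.le] at hx
        have := hx.1; simp only [Set.mem_compl_iff, Set.mem_singleton_iff]; linarith))
      (by
        intro x hx
        rw [min_eq_left hκ.le, max_eq_right hκ.le] at hx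
        exact (Real.hasDerivAt_log (by linarith [hx.1])).hasDerivWithinAt)
      (((hcont θ hθ).pow 2).div_const _).continuousOn
      ((((hcont θ hθ).pow 2).div_const _).continuousOn.integrableOn_compact (by
        apply isCompact_uIcc.image_of_continuousOn
        apply Real.continuousOn_log.mono
        intro x hx; rw [Set.uIcc_of_le hκ.le] at hx
        have := hx.1; simp only [Set.mem_compl_iff, Set.mem_singleton_iff]; linarith))
      (by
        apply ContinuousOn.integrableOn_compact isCompact_uIcc
        have hlog : ContinuousOn Real.log (Set.uIcc 1 κ) := by
          apply Real.continuousOn_log.mono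
          intro x hx; rw [Set.uIcc_of_le hκ.le] at hx
          have := hx.1; simp only [Set.mem_compl_iff, Set.mem_singleton_iff]; linarith
        refine ((((hcont θ hθ).pow 2).div_const _).comp_continuousOn hlog).mul ?_
        apply continuousOn_id.inv₀
        intro x hx; rw [Set.uIcc_of_le hκ.le] at hx
        have := hx.1; simp only [id]; linarith)
    rw [Real.log_one] at hcv
    rw [← hcv]
    apply intervalIntegral.integral_congr
    intro x hx
    rw [Set.uIcc_of_le hκ.le] at hx
    have hx0 : 0 < x := by linarith [hx.1]
    simp only [Function.comp]
    rw [Complex.exp_add, ← Complex.ofReal_exp, Real.exp_log hx0]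
    field_simp
  have hinv : IntegrableOn (fun θ : ℝ => c * θ⁻¹) (Set.Ioo 0 δ) := by
    refine Integrable.mono' hJ2 (by fun_prop) ?_
    rw [ae_restrict_iff' measurableSet_Ioo]
    refine Filter.Eventually.of_forall fun θ hθ => ?_
    have hθα : θ ∈ Set.Ioo 0 α := ⟨hθ.1, hθ.2.trans hδα⟩
    have h0 := hθ.1
    have hsp : 0 < Real.sin θ := Real.sin_pos_of_pos_of_lt_pi h0 (by linarith [hθα.2, Real.pi_pos])
    rw [hval θ hθα, Real.norm_of_nonneg (by positivity), le_div_iff₀ (by positivity)]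
    refine le_trans ?_ (hall θ hθ)
    have h2 : Real.sin θ ^ 2 ≤ θ ^ 2 := pow_le_pow_left₀ hsp.le (Real.sin_le h0.le) 2
    calc c * θ⁻¹ * Real.sin θ ^ 2 ≤ c * θ⁻¹ * θ ^ 2 := by gcongr
      _ = c * θ := by field_simp
  have hinv2 : IntegrableOn (fun θ : ℝ => θ⁻¹) (Set.Ioo 0 δ) := by
    have := hinv.const_mul c⁻¹
    simpa [IntegrableOn, ← mul_assoc, inv_mul_cancel₀ hc.ne'] using this
  have := (intervalIntegrable_iff_integrableOn_Ioo_of_le hδ.le).2 hinv2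
  rw [intervalIntegrable_inv_iff] at this
  rcases this with h | h
  · linarith
  · exact h Set.left_mem_uIcc

theorem flare_radial_bound (κ α s : ℝ) (hκ : 1 < κ)
    (hα0 : 0 < α) (hαpi : α < Real.pi / 2)
    (hs : 1 / 2 < s) (hs1 : s < 1)
    (φ : ℂ → ℝ)
    (hsmooth : ContDiffOn ℝ (⊤ : ℕ∞) φ {z : ℂ | 0 < z.arg ∧ z.arg < α})
    (hper : ∀ z : ℂ, 0 < z.arg → z.arg < α → φ (κ * z) = φ z)
    (heig : ∀ z : ℂ, 0 < z.arg → z.arg < α →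
      -(z.im ^ 2) * (partialXX φ z + partialYY φ z) = s * (1 - s) * φ z)
    (hL2 : IntegrableOn
      (fun p : ℝ × ℝ =>
        φ (p.1 * Complex.exp (p.2 * Complex.I)) ^ 2 / (p.1 * Real.sin p.2 ^ 2))
      (Set.Ioo 1 κ ×ˢ Set.Ioo 0 α)) :
    ∃ C : ℝ, 0 < C ∧ ∃ θ₀ : ℝ, 0 < θ₀ ∧ θ₀ < α ∧
      ∀ r θ : ℝ, 0 < r → 0 < θ → θ < θ₀ →
        |φ (r * Complex.exp (θ * Complex.I))| ≤ C * θ ^ s := by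
  have hS := isOpen_sector α hαpi
  set S : Set ℂ := {z : ℂ | 0 < z.arg ∧ z.arg < α} with hSdef
  have hmem : ∀ t θ : ℝ, θ ∈ Set.Ioo 0 α → Complex.exp (t + θ * Complex.I) ∈ S := by
    intro t θ hθ
    have := arg_polar t θ α hαpi hθ
    simp only [hSdef, Set.mem_setOf_eq, this]
    exact hθ
  have c0 : ContinuousOn φ S := hsmooth.continuousOn
  have s1 : ContDiffOn ℝ (⊤ : ℕ∞) (fderiv ℝ φ) S := hsmooth.fderiv_of_isOpen hS (by simp)
  have s2 : ContDiffOn ℝ (⊤ : ℕ∞) (fderiv ℝ (fderiv ℝ φ)) S := s1.fderiv_of_isOpen hS (by simp)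
  have cE : ContinuousOn (fun p : ℝ × ℝ => Complex.exp (p.1 + p.2 * Complex.I)) (Set.univ ×ˢ Set.Ioo 0 α) := by
    apply Continuous.continuousOn; fun_prop
  have mE : Set.MapsTo (fun p : ℝ × ℝ => Complex.exp (p.1 + p.2 * Complex.I)) (Set.univ ×ˢ Set.Ioo 0 α) S :=
    fun p hp => hmem p.1 p.2 hp.2
  have k0 := c0.comp cE mE
  have k1 := s1.continuousOn.comp cE mE
  have k2 := s2.continuousOn.comp cE mE
  have cI : ContinuousOn (fun p : ℝ × ℝ => Complex.I * Complex.exp (p.1 + p.2 * Complex.I)) (Set.univ ×ˢ Set.Ioo 0 α) :=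
    continuousOn_const.mul cE
  have cII : ContinuousOn (fun p : ℝ × ℝ => Complex.I * (Complex.I * Complex.exp (p.1 + p.2 * Complex.I))) (Set.univ ×ˢ Set.Ioo 0 α) :=
    continuousOn_const.mul cI
  have dEt : ∀ t θ : ℝ, HasDerivAt (fun t : ℝ => Complex.exp (t + θ * Complex.I)) (Complex.exp (t + θ * Complex.I)) t := by
    intro t θ
    have := ((Complex.ofRealCLM.hasDerivAt (x := t)).add_const (θ * Complex.I)).cexp
    simpa using this
  have dEh : ∀ t θ : ℝ, HasDerivAt (fun θ : ℝ => Complex.exp (t + θ * Complex.I)) (Complex.I * Complex.exp (t + θ * Complex.I)) θ := by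
    intro t θ
    have := (((Complex.ofRealCLM.hasDerivAt (x := θ)).mul_const Complex.I).const_add (t : ℂ)).cexp
    simpa [mul_comm] using this
  have ct := fun (t θ : ℝ) (hθ : θ ∈ Set.Ioo 0 α) => curve_deriv φ S hS hsmooth
    (fun t : ℝ => Complex.exp (t + θ * Complex.I)) (fun t : ℝ => Complex.exp (t + θ * Complex.I)) _ t
    (dEt t θ) (dEt t θ) (hmem t θ hθ)
  have ch := fun (t θ : ℝ) (hθ : θ ∈ Set.Ioo 0 α) => curve_deriv φ S hS hsmooth
    (fun θ : ℝ => Complex.exp (t + θ * Complex.I)) (fun θ : ℝ => Complex.I * Complex.exp (t + θ * Complex.I)) _ θ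
    (dEh t θ) ((dEh t θ).const_mul Complex.I) (hmem t θ hθ)
  have hκ0 : 0 < κ := by linarith
  obtain ⟨C, hC, hb⟩ := flare_core α s (Real.log κ) hα0 hαpi (by linarith) (Real.log_pos hκ)
    (fun t θ => φ (Complex.exp (t + θ * Complex.I)))
    (fun t θ => fderiv ℝ φ (Complex.exp (t + θ * Complex.I)) (Complex.exp (t + θ * Complex.I)))
    _ 
    (fun t θ => fderiv ℝ φ (Complex.exp (t + θ * Complex.I)) (Complex.I * Complex.exp (t + θ * Complex.I)))
    _ k0 (k1.clm_apply cE) (((k2.clm_apply cE).clm_apply cE).add (k1.clm_apply cE))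
    (k1.clm_apply cI) (((k2.clm_apply cI).clm_apply cI).add (k1.clm_apply cII))
    (fun t θ hθ => (ct t θ hθ).1) (fun t θ hθ => (ct t θ hθ).2)
    (fun t θ hθ => (ch t θ hθ).1) (fun t θ hθ => (ch t θ hθ).2)
    (by
      intro t θ hθ
      have h1 := hper _ (hmem t θ hθ).1 (hmem t θ hθ).2
      rw [← h1]
      congr 1
      push_cast
      rw [show (t : ℂ) + Real.log κ + θ * Complex.I = Real.log κ + (t + θ * Complex.I) by ring,
        Complex.exp_add (Real.log κ : ℂ), ← Complex.ofReal_exp, Real.exp_log hκ0])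
    (by
      intro t θ hθ
      exact flare_pde α s hαpi φ hsmooth heig _ (Real.exp t) θ (Real.exp_pos t)
        (by rw [Complex.exp_add, Complex.ofReal_exp]) (hmem t θ hθ)
        (Real.sin_pos_of_pos_of_lt_pi hθ.1 (by linarith [hθ.2, Real.pi_pos])))
    (flare_no κ α hκ hα0 hαpi φ (fun θ hθ => c0.comp_continuous (by fun_prop) (fun t => hmem t θ hθ)) hL2)
  refine ⟨C, hC, α / 2, by linarith, by linarith, ?_⟩
  intro r θ hr h0 h1
  have := hb (Real.log r) θ h0 h1
  rwa [Complex.exp_add, ← Complex.ofReal_exp, Real.exp_log hr] at this
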